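/- Let κ be a bounded kernel and let c ≥ 0 be a constant. Then s(T, κ) = c^{e(T)} for every finite tree T if and only if κ is homogeneous with degree c, i.e. ∫₀¹ κ(x,y) dy = c for almost every x ∈ [0,1]. -/

import Mathlib

open MeasureTheory Set Filter

noncomputable section
open scoped Classical

/-- `κ` is a kernel: a symmetric, measurable, nonnegative function on `[0,1]²`,
integrable on `[0,1]²`. -/
def IsKernel (κ : ℝ → ℝ → ℝ) : Prop :=
  Measurable (Function.uncurry κ) ∧ (∀ x y, κ x y = κ y x) ∧ (∀ x y, 0 ≤ κ x y) ∧
    IntegrableOn (Function.uncurry κ) (Set.Icc 0 1 ×ˢ Set.Icc 0 1)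

/-- The cube `[0,1]ᵏ`. -/
def typeCube (k : ℕ) : Set (Fin k → ℝ) := Set.univ.pi fun _ => Set.Icc (0:ℝ) 1

/-- The homomorphism density
`s(F,κ) = ∫_{[0,1]^k} ∏_{ij ∈ E(F)} κ(x_i,x_j) dx₁⋯dx_k`
of a finite graph `F` on vertex set `Fin k` in a kernel `κ`. -/
def sDensity {k : ℕ} (F : SimpleGraph (Fin k)) (κ : ℝ → ℝ → ℝ) : ℝ :=
  ∫ x in typeCube k,
    ∏ q ∈ Finset.univ.filter (fun q : Fin k × Fin k => q.1 < q.2 ∧ F.Adj q.1 q.2),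
      κ (x q.1) (x q.2)

/-- Lebesgue measure on `[0,1]`. -/
abbrev unitMeasure : Measure ℝ := volume.restrict (Set.Icc (0:ℝ) 1)

instance isProbabilityMeasure_unitMeasure : IsProbabilityMeasure unitMeasure :=
  ⟨by simp [unitMeasure]⟩

/-- The degree function `x ↦ ∫₀¹ κ(x,y) dy` of a kernel. -/
def kernelDegree (κ : ℝ → ℝ → ℝ) (x : ℝ) : ℝ := ∫ y, κ x y ∂unitMeasure

/-- The product of `κ` over the edges of `F`. -/
def edgeProd {k : ℕ} (F : SimpleGraph (Fin k)) (κ : ℝ → ℝ → ℝ) (x : Fin k → ℝ) : ℝ :=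
  ∏ q ∈ Finset.univ.filter (fun q : Fin k × Fin k => q.1 < q.2 ∧ F.Adj q.1 q.2),
    κ (x q.1) (x q.2)

lemma volume_restrict_typeCube (k : ℕ) :
    (volume : Measure (Fin k → ℝ)).restrict (typeCube k) = Measure.pi fun _ => unitMeasure := by
  rw [typeCube, volume_pi, Measure.restrict_pi_pi]

lemma sDensity_eq_integral_edgeProd {k : ℕ} (F : SimpleGraph (Fin k)) (κ : ℝ → ℝ → ℝ) :
    sDensity F κ = ∫ x, edgeProd F κ x ∂(Measure.pi fun _ => unitMeasure) := by
  rw [← volume_restrict_typeCube]; rfl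

section Bounded

variable {κ : ℝ → ℝ → ℝ} {B : ℝ}

lemma measurable_kernelDegree (hm : Measurable (Function.uncurry κ)) :
    Measurable (kernelDegree κ) :=
  (hm.stronglyMeasurable.integral_prod_right).measurable

lemma abs_kernelDegree_le (hB : ∀ x y, |κ x y| ≤ B) (x : ℝ) : |kernelDegree κ x| ≤ B := by
  simpa [kernelDegree] using
    norm_integral_le_of_norm_le_const (μ := unitMeasure) (f := κ x) (ae_of_all _ (hB x))

lemma measurable_edgeProd {k : ℕ} (F : SimpleGraph (Fin k))
    (hm : Measurable (Function.uncurry κ)) : Measurable (edgeProd F κ) :=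
  Finset.measurable_prod _ fun q _ =>
    hm.comp (f := fun x : Fin k → ℝ => (x q.1, x q.2))
      ((measurable_pi_apply q.1).prodMk (measurable_pi_apply q.2))

lemma exists_abs_edgeProd_le {k : ℕ} (F : SimpleGraph (Fin k)) (hB : ∀ x y, |κ x y| ≤ B) :
    ∃ C, ∀ x, |edgeProd F κ x| ≤ C :=
  ⟨_, fun x => by
    rw [edgeProd, Finset.abs_prod]
    exact Finset.prod_le_prod (fun _ _ => abs_nonneg _) fun q _ => hB _ _⟩

end Bounded

/-- Splitting off a pendant vertex `v` attached to `u` from the edge product. -/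
lemma edgeProd_eq_mul_of_pendant {k : ℕ} {T : SimpleGraph (Fin (k + 1))} {κ : ℝ → ℝ → ℝ}
    (hs : ∀ x y, κ x y = κ y x) {v : Fin (k + 1)} {u : Fin k}
    (huv : ∀ b, T.Adj v (v.succAbove b) ↔ b = u) (x : Fin (k + 1) → ℝ) :
    edgeProd T κ x =
      κ (x (v.succAbove u)) (x v) * edgeProd (T.comap v.succAbove) κ (v.removeNth x) := by
  have key : ∀ b : Fin k,
      (if v < v.succAbove b ∧ T.Adj v (v.succAbove b) then κ (x v) (x (v.succAbove b)) else 1) *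
      (if v.succAbove b < v ∧ T.Adj (v.succAbove b) v then κ (x (v.succAbove b)) (x v) else 1) =
      if b = u then κ (x (v.succAbove u)) (x v) else 1 := by
    intro b
    rw [T.adj_comm _ v, huv]
    by_cases hb : b = u
    · subst hb
      rcases lt_or_gt_of_ne (v.succAbove_ne b) with h | h
      · simp [h, h.not_gt]
      · simp [h, h.not_gt, hs (x v)]
    · simp [hb]
  simp only [edgeProd, Finset.prod_filter, Fintype.prod_prod_type]
  rw [Fin.prod_univ_succAbove _ v, Fin.prod_univ_succAbove _ v]
  simp_rw [Fin.prod_univ_succAbove _ v]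
  rw [Finset.prod_mul_distrib]
  simp only [lt_self_iff_false, false_and, if_false, one_mul]
  rw [← mul_assoc, ← Finset.prod_mul_distrib, Finset.prod_congr rfl fun b _ => key b]
  simp [Fin.removeNth]

/-- Integrating out the variable of a pendant vertex produces the degree function. -/
lemma integral_kernel_mul_removeNth {k : ℕ} {κ : ℝ → ℝ → ℝ} {B : ℝ}
    (hm : Measurable (Function.uncurry κ)) (hB : ∀ x y, |κ x y| ≤ B)
    {G : (Fin k → ℝ) → ℝ} {C : ℝ} (hGm : Measurable G) (hGb : ∀ y, |G y| ≤ C)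
    (v : Fin (k + 1)) (u : Fin k) :
    ∫ x, κ (x (v.succAbove u)) (x v) * G (v.removeNth x) ∂(Measure.pi fun _ => unitMeasure) =
      ∫ y, kernelDegree κ (y u) * G y ∂(Measure.pi fun _ => unitMeasure) := by
  let f : ℝ × (Fin k → ℝ) → ℝ := fun p => κ (p.2 u) p.1 * G p.2
  have hf : Integrable f (unitMeasure.prod (Measure.pi fun _ => unitMeasure)) := by
    refine Integrable.of_bound (C := B * C) (Measurable.aestronglyMeasurable ?_)
      (ae_of_all _ fun p => ?_)
    · exact (hm.comp (((measurable_pi_apply u).comp measurable_snd).prodMk measurable_fst)).mul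
        (hGm.comp measurable_snd)
    · rw [Real.norm_eq_abs, abs_mul]
      exact mul_le_mul (hB _ _) (hGb _) (abs_nonneg _) ((abs_nonneg _).trans (hB 0 0))
  calc _ = ∫ p, f p ∂(unitMeasure.prod (Measure.pi fun _ => unitMeasure)) :=
        (measurePreserving_piFinSuccAbove (fun _ : Fin (k + 1) => unitMeasure) v).integral_comp' f
    _ = _ := by
        rw [integral_prod_symm _ hf]
        simp only [f, integral_mul_const, kernelDegree]

lemma SimpleGraph.IsTree.exists_pendant {k : ℕ} {T : SimpleGraph (Fin (k + 2))} (hT : T.IsTree) :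
    ∃ (v : Fin (k + 2)) (u : Fin (k + 1)), (∀ b, T.Adj v (v.succAbove b) ↔ b = u) ∧
      (T.comap v.succAbove).IsTree := by
  obtain ⟨v, hv⟩ := hT.exists_vert_degree_one_of_nontrivial
  obtain ⟨w, hw, hw'⟩ := SimpleGraph.degree_eq_one_iff_existsUnique_adj.mp hv
  obtain ⟨u, rfl⟩ := Fin.exists_succAbove_eq hw.ne'
  refine ⟨v, u, fun b => ⟨fun h => v.succAbove_right_injective (hw' _ h), fun h => h ▸ hw⟩, ?_,
    hT.isAcyclic.of_comap v.succAboveEmb⟩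
  have hc := hT.connected.induce_compl_singleton_of_degree_eq_one hv
  let e : (T.comap v.succAbove) ≃g T.induce ({v}ᶜ : Set (Fin (k + 2))) :=
    { toEquiv := finSuccAboveEquiv v, map_rel_iff' := Iff.rfl }
  exact e.connected_iff.mpr hc

lemma sDensity_eq_pow_of_homogeneous {κ : ℝ → ℝ → ℝ} {B c : ℝ}
    (hm : Measurable (Function.uncurry κ)) (hs : ∀ x y, κ x y = κ y x)
    (hB : ∀ x y, |κ x y| ≤ B) (h : ∀ᵐ x ∂unitMeasure, kernelDegree κ x = c) (k : ℕ)
    (T : SimpleGraph (Fin (k + 1))) (hT : T.IsTree) : sDensity T κ = c ^ k := by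
  induction k with
  | zero =>
    have : edgeProd T κ = fun _ => 1 := by
      funext x
      refine Finset.prod_eq_one fun q hq => ?_
      have := (Finset.mem_filter.mp hq).2.1
      omega
    simp [sDensity_eq_integral_edgeProd, this]
  | succ k ih =>
    obtain ⟨v, u, huv, hT'⟩ := hT.exists_pendant
    obtain ⟨C, hC⟩ := exists_abs_edgeProd_le (T.comap v.succAbove) hB
    rw [sDensity_eq_integral_edgeProd, funext (edgeProd_eq_mul_of_pendant hs huv),
      integral_kernel_mul_removeNth hm hB (measurable_edgeProd _ hm) hC, pow_succ', ← ih _ hT',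
      sDensity_eq_integral_edgeProd, ← integral_const_mul]
    refine integral_congr_ae ?_
    filter_upwards [Measure.tendsto_eval_ae_ae.eventually h] with y hy
    rw [← hy]

lemma edgeProd_one (F : SimpleGraph (Fin 1)) (κ : ℝ → ℝ → ℝ) (x : Fin 1 → ℝ) :
    edgeProd F κ x = 1 :=
  Finset.prod_eq_one fun q hq => by
    have := (Finset.mem_filter.mp hq).2.1
    omega

lemma integral_pi_fin_one (f : ℝ → ℝ) :
    ∫ y : Fin 1 → ℝ, f (y 0) ∂(Measure.pi fun _ => unitMeasure) = ∫ x, f x ∂unitMeasure :=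
  (measurePreserving_piUnique fun _ : Fin 1 => unitMeasure).integral_comp' f

section Star

variable {κ : ℝ → ℝ → ℝ} {B : ℝ}

lemma sDensity_starGraph_two (hm : Measurable (Function.uncurry κ))
    (hs : ∀ x y, κ x y = κ y x) (hB : ∀ x y, |κ x y| ≤ B) :
    sDensity (SimpleGraph.starGraph (0 : Fin 2)) κ = ∫ x, kernelDegree κ x ∂unitMeasure := by
  have huv : ∀ b : Fin 1, (SimpleGraph.starGraph (0 : Fin 2)).Adj 1 ((1 : Fin 2).succAbove b) ↔
      b = 0 := by
    simp only [SimpleGraph.starGraph_adj]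
    decide
  rw [sDensity_eq_integral_edgeProd, funext (edgeProd_eq_mul_of_pendant hs huv),
    integral_kernel_mul_removeNth hm hB (measurable_edgeProd _ hm) (C := 1)
      (by simp [edgeProd_one])]
  simp only [edgeProd_one, mul_one]
  exact integral_pi_fin_one _

lemma sDensity_starGraph_three (hm : Measurable (Function.uncurry κ))
    (hs : ∀ x y, κ x y = κ y x) (hB : ∀ x y, |κ x y| ≤ B) :
    sDensity (SimpleGraph.starGraph (0 : Fin 3)) κ = ∫ x, kernelDegree κ x ^ 2 ∂unitMeasure := by
  have huv : ∀ b : Fin 2, (SimpleGraph.starGraph (0 : Fin 3)).Adj 2 ((2 : Fin 3).succAbove b) ↔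
      b = 0 := by
    simp only [SimpleGraph.starGraph_adj]
    decide
  have huv' : ∀ b : Fin 1, ((SimpleGraph.starGraph (0 : Fin 3)).comap (2 : Fin 3).succAbove).Adj 1
      ((1 : Fin 2).succAbove b) ↔ b = 0 := by
    simp only [SimpleGraph.starGraph_adj, SimpleGraph.comap_adj]
    decide
  obtain ⟨C, hC⟩ := exists_abs_edgeProd_le
    ((SimpleGraph.starGraph (0 : Fin 3)).comap (2 : Fin 3).succAbove) hB
  rw [sDensity_eq_integral_edgeProd, funext (edgeProd_eq_mul_of_pendant hs huv),
    integral_kernel_mul_removeNth hm hB (measurable_edgeProd _ hm) hC]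
  have hd : Measurable fun y : Fin 1 → ℝ => kernelDegree κ (y 0) :=
    (measurable_kernelDegree hm).comp (measurable_pi_apply 0)
  have := integral_kernel_mul_removeNth hm hB hd (fun y => abs_kernelDegree_le hB (y 0)) 1 0
  rw [← integral_pi_fin_one fun x => kernelDegree κ x ^ 2]
  simp only [pow_two]
  rw [← this]
  refine integral_congr_ae (ae_of_all _ fun y => ?_)
  simp only [edgeProd_eq_mul_of_pendant hs huv', edgeProd_one, mul_one]
  exact mul_comm _ _

end Star

/-- Let `κ` be a bounded kernel and `c ≥ 0` a constant.  Then
`s(T,κ) = c^{e(T)}` for every finite tree `T` (a finite connected acyclic graph, with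
`e(T)` its number of edges) if and only if `κ` is homogeneous with degree `c`, i.e.
`∫₀¹ κ(x,y) dy = c` for almost every `x ∈ [0,1]`. -/
theorem tree_densities_eq_iff_homogeneous
    (κ : ℝ → ℝ → ℝ) (hκ : IsKernel κ) (hbdd : ∃ B : ℝ, ∀ x y, κ x y ≤ B)
    (c : ℝ) (hc : 0 ≤ c) :
    (∀ (k : ℕ) (T : SimpleGraph (Fin k)), T.Connected → T.IsAcyclic →
        sDensity T κ = c ^ (Nat.card T.edgeSet)) ↔
      (∀ᵐ x ∂(volume.restrict (Set.Icc (0:ℝ) 1)),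
        (∫ y in Set.Icc (0:ℝ) 1, κ x y) = c) := by
  obtain ⟨hm, hs, h0, -⟩ := hκ
  obtain ⟨B, hB⟩ := hbdd
  replace hB : ∀ x y, |κ x y| ≤ B := fun x y => (abs_of_nonneg (h0 x y)).trans_le (hB x y)
  constructor
  · intro h
    have hstar : ∀ k, sDensity (SimpleGraph.starGraph (0 : Fin (k + 1))) κ = c ^ k := by
      intro k
      have hT := SimpleGraph.isTree_starGraph (0 : Fin (k + 1))
      have hcard := hT.card_edgeFinset
      rw [h _ _ hT.connected hT.isAcyclic, Nat.card_eq_fintype_card, ← SimpleGraph.edgeFinset_card]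
      simp only [Fintype.card_fin, Nat.add_right_cancel_iff] at hcard
      rw [hcard]
    have h1 : ∫ x, kernelDegree κ x ∂unitMeasure = c := by
      rw [← sDensity_starGraph_two hm hs hB, hstar 1, pow_one]
    have h2 : ∫ x, kernelDegree κ x ^ 2 ∂unitMeasure = c ^ 2 := by
      rw [← sDensity_starGraph_three hm hs hB, hstar 2]
    have hd := measurable_kernelDegree hm
    have hi1 : Integrable (kernelDegree κ) unitMeasure :=
      .of_bound hd.aestronglyMeasurable B (ae_of_all _ (abs_kernelDegree_le hB))
    have hi2 : Integrable (fun x => kernelDegree κ x ^ 2) unitMeasure :=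
      .of_bound (hd.pow_const 2).aestronglyMeasurable (B ^ 2) (ae_of_all _ fun x => by
        rw [norm_pow]
        exact pow_le_pow_left₀ (norm_nonneg _) (abs_kernelDegree_le hB x) 2)
    have hsq : (fun x => (kernelDegree κ x - c) ^ 2) =
        fun x => kernelDegree κ x ^ 2 - 2 * c * kernelDegree κ x + c ^ 2 := by
      funext x; ring
    have hi : Integrable (fun x => kernelDegree κ x ^ 2 - 2 * c * kernelDegree κ x) unitMeasure :=
      hi2.sub (hi1.const_mul _)
    have hz : ∫ x, (kernelDegree κ x - c) ^ 2 ∂unitMeasure = 0 := by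
      rw [hsq, integral_add hi (integrable_const _), integral_sub hi2 (hi1.const_mul _),
        integral_const_mul, h1, h2, integral_const, probReal_univ, one_smul]
      ring
    rw [integral_eq_zero_iff_of_nonneg (fun x => sq_nonneg _)
      (hsq ▸ hi.add (integrable_const _))] at hz
    filter_upwards [hz] with x hx
    exact sub_eq_zero.mp (pow_eq_zero_iff two_ne_zero |>.mp hx)
  · intro h k T hconn hacyc
    have hT : T.IsTree := ⟨hconn, hacyc⟩
    obtain _ | k := k
    · exact hconn.nonempty.some.elim0
    have hcard := hT.card_edgeFinset
    simp only [Fintype.card_fin, Nat.add_right_cancel_iff] at hcard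
    rw [sDensity_eq_pow_of_homogeneous hm hs hB h k T hT, Nat.card_eq_fintype_card,
      ← SimpleGraph.edgeFinset_card, hcard]
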